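/- arXiv:1806.00652 — 2 statements merged into one kernel-verified Lean document; each statement's English description precedes it below -/
import Mathlib

section
/- Assume (f) and (D1) with threshold α ∈ (0,1), let ℓ⁻ ∈ [0,α), ℓ⁺ ∈ (α,1], assume the chord conditions with common slope c, and assume additionally D′(α) < 0. For each ε ∈ (0,1] let φ_ε be the unique wavefront profile of ρ_t + f(ρ)_x = ε(D(ρ)ρ_x)_x from ℓ⁻ to ℓ⁺ normalized by φ_ε(0) = α, φ_ε(ξ) < α for ξ < 0, φ_ε(ξ) > α for ξ > 0. Then, as ε → 0⁺, φ_ε(ξ) → ℓ⁻ for every ξ < 0 and φ_ε(ξ) → ℓ⁺ for every ξ > 0, and for every δ > 0 the convergence is uniform on (−∞, −δ] and on [δ, +∞). -/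
open Set Filter MeasureTheory Topology

/-- A traveling-wave profile of `ρ_t + f(ρ)_x = (D(ρ)ρ_x)_x` with speed `c`:
a continuous `φ : ℝ → [0,1]`, differentiable off a countable set, with
`D(φ)φ'` locally integrable, satisfying the weak form of the profile ODE. -/
def IsTWProfile (f D : ℝ → ℝ) (c : ℝ) (φ : ℝ → ℝ) : Prop :=
  Continuous φ ∧ (∀ ξ, φ ξ ∈ Icc (0:ℝ) 1) ∧
  (∃ S : Set ℝ, S.Countable ∧ ∀ ξ ∉ S, DifferentiableAt ℝ φ ξ) ∧
  LocallyIntegrable (fun ξ => D (φ ξ) * deriv φ ξ) ∧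
  ∀ ψ : ℝ → ℝ, ContDiff ℝ (⊤ : ℕ∞) ψ → HasCompactSupport ψ →
    ∫ ξ, (D (φ ξ) * deriv φ ξ - f (φ ξ) + c * φ ξ) * deriv ψ ξ = 0

/-- A wavefront from `ℓm` to `ℓp`: a monotone, non-constant traveling-wave
profile with limits `ℓm` at `-∞` and `ℓp` at `+∞`. -/
def IsWavefront (f D : ℝ → ℝ) (c ℓm ℓp : ℝ) (φ : ℝ → ℝ) : Prop :=
  IsTWProfile f D c φ ∧ (Monotone φ ∨ Antitone φ) ∧ (∃ x y, φ x ≠ φ y) ∧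
  Tendsto φ atBot (𝓝 ℓm) ∧ Tendsto φ atTop (𝓝 ℓp)


lemma core_id (a b ε : ℝ) (q u : ℝ → ℝ)
    (hq : ContinuousOn q (Ioo a b)) (hu : Continuous u) (hm : Monotone u)
    (hlt : ∀ ξ < 0, u ξ < b) (S : Set ℝ) (hS : S.Countable)
    (hd : ∀ ξ ∉ S, ξ < 0 → a < u ξ → ∃ d, HasDerivAt u d ξ ∧ q (u ξ) * d = ε⁻¹)
    (x y : ℝ) (hxy : x ≤ y) (hy : y < 0) (hx : a < u x) :
    ∫ r in (u x)..(u y), q r = (y - x) * ε⁻¹ := by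
  have hmem : ∀ ξ ∈ Icc x y, u ξ ∈ Ioo a b := fun ξ h =>
    ⟨hx.trans_le (hm h.1), hlt ξ (h.2.trans_lt hy)⟩
  have hxm := hmem x ⟨le_rfl, hxy⟩
  have hF : ∀ r ∈ Ioo a b, HasDerivAt (fun r => ∫ s in (u x)..r, q s) (q r) r := by
    intro r hr
    have hsub : uIcc (u x) r ⊆ Ioo a b := (ordConnected_Ioo).uIcc_subset hxm hr
    apply intervalIntegral.integral_hasDerivAt_right
    · exact (hq.mono hsub).intervalIntegrable
    · exact hq.stronglyMeasurableAtFilter isOpen_Ioo r hr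
    · exact hq.continuousAt (isOpen_Ioo.mem_nhds hr)
  have := MeasureTheory.integral_eq_of_hasDerivAt_off_countable_of_le
    (fun ξ => ∫ s in (u x)..(u ξ), q s) (fun _ => ε⁻¹) hxy hS
    (fun ξ hξ => ((hF _ (hmem ξ hξ)).continuousAt.comp hu.continuousAt).continuousWithinAt)
    (fun ξ hξ => by
      obtain ⟨d, h1, h2⟩ := hd ξ hξ.2 (hξ.1.2.trans hy) (hmem ξ ⟨hξ.1.1.le, hξ.1.2.le⟩).1
      rw [← h2]
      exact (hF _ (hmem ξ ⟨hξ.1.1.le, hξ.1.2.le⟩)).comp ξ h1)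
    (by simp)
  simp at this
  rw [← this]

lemma core (a b : ℝ) (hab : a < b) (q : ℝ → ℝ) (u : ℝ → ℝ → ℝ)
    (hq : ContinuousOn q (Ioo a b)) (hq0 : ∀ r ∈ Ioo a b, 0 < q r)
    (hu : ∀ ε ∈ Ioc (0:ℝ) 1, Continuous (u ε) ∧ Monotone (u ε) ∧ u ε 0 = b ∧
      (∀ ξ < 0, u ε ξ < b) ∧ Tendsto (u ε) atBot (𝓝 a) ∧
      ∃ S : Set ℝ, S.Countable ∧
        ∀ ξ ∉ S, ξ < 0 → a < u ε ξ → ∃ d, HasDerivAt (u ε) d ξ ∧ q (u ε ξ) * d = ε⁻¹)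
    (δ : ℝ) (hδ : 0 < δ) (η : ℝ) (hη : 0 < η) :
    ∀ᶠ ε in 𝓝[Ioc (0:ℝ) 1] 0, ∀ ξ ≤ -δ, a ≤ u ε ξ ∧ u ε ξ < a + η := by
  obtain ⟨r, hr1, hr2⟩ : ∃ r, a < r ∧ r < min b (a + η) := exists_between (by simp [hab, hη])
  obtain ⟨hrb, hrη⟩ := lt_min_iff.1 hr2
  obtain ⟨c1, m1, z1, l1, t1, S1, hS1, d1⟩ := hu 1 (by norm_num)
  -- preimages
  obtain ⟨ξ0, hξ00, hξ0⟩ : ∃ ξ0 < 0, u 1 ξ0 < r :=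
    ((eventually_lt_atBot (0:ℝ)).and (t1.eventually (eventually_lt_nhds hr1))).exists
  have pre : ∀ s, r ≤ s → s < b → ∃ ξ ∈ Icc ξ0 0, u 1 ξ = s := fun s h1 h2 =>
    intermediate_value_Icc hξ00.le c1.continuousOn ⟨by linarith, by linarith⟩
  obtain ⟨ξ1, hξ1, e1⟩ := pre r le_rfl hrb
  have H : ∀ s, r ≤ s → s < b → ∫ t in r..s, q t ≤ -ξ1 := by
    intro s h1 h2
    obtain ⟨ξ, hξ, e⟩ := pre s h1 h2
    have hn : ξ < 0 := lt_of_le_of_ne hξ.2 (by rintro rfl; linarith)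
    rcases le_total ξ1 ξ with h | h
    · have := core_id a b 1 q (u 1) hq c1 m1 l1 S1 hS1 d1 ξ1 ξ h hn (by linarith)
      rw [e1, e] at this
      rw [this]; simp; linarith
    · have : s = r := le_antisymm (by rw [← e, ← e1]; exact m1 h) h1
      subst this; simp; linarith [hξ1.2]
  have ev : ∀ᶠ ε in 𝓝[Ioc (0:ℝ) 1] 0, -ξ1 < δ / 2 * ε⁻¹ := by
    have : Tendsto (fun ε : ℝ => δ / 2 * ε⁻¹) (𝓝[>] 0) atTop :=
      tendsto_inv_nhdsGT_zero.const_mul_atTop (by positivity)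
    exact (this.mono_left (nhdsWithin_mono _ Ioc_subset_Ioi_self)).eventually_gt_atTop _
  filter_upwards [ev, self_mem_nhdsWithin] with ε hε hε1 ξ hξ
  obtain ⟨c2, m2, z2, l2, t2, S2, hS2, d2⟩ := hu ε hε1
  refine ⟨m2.le_of_tendsto t2 ξ, ?_⟩
  by_contra hcon
  have hge : r ≤ u ε (-δ) := by linarith [m2 hξ]
  have hm : u ε (-δ) ≤ u ε (-(δ/2)) := m2 (by linarith)
  have hl : u ε (-(δ/2)) < b := l2 _ (by linarith)
  have h1 := core_id a b ε q (u ε) hq c2 m2 l2 S2 hS2 d2 (-δ) (-(δ/2)) (by linarith)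
    (by linarith) (by linarith)
  have h2 := H _ (hge.trans hm) hl
  have hI : ∀ x y, x ∈ Ioo a b → y ∈ Ioo a b → IntervalIntegrable q volume x y :=
    fun x y hx hy => (hq.mono ((ordConnected_Ioo).uIcc_subset hx hy)).intervalIntegrable
  have h3 := intervalIntegral.integral_add_adjacent_intervals
    (hI r (u ε (-δ)) ⟨hr1, hrb⟩ ⟨by linarith, by linarith⟩)
    (hI (u ε (-δ)) (u ε (-(δ/2))) ⟨by linarith, by linarith⟩ ⟨by linarith, by linarith⟩)
  have h4 : 0 ≤ ∫ t in r..(u ε (-δ)), q t := intervalIntegral.integral_nonneg hge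
    fun t ht => (hq0 t ⟨by linarith [ht.1], by linarith [ht.2]⟩).le
  have : -(δ/2) - -δ = δ/2 := by ring
  rw [this] at h1
  linarith

lemma exists_primitive (χ : ℝ → ℝ) (h1 : ContDiff ℝ (⊤ : ℕ∞) χ) (h2 : HasCompactSupport χ)
    (h3 : ∫ x, χ x = 0) :
    ∃ ψ : ℝ → ℝ, ContDiff ℝ (⊤ : ℕ∞) ψ ∧ HasCompactSupport ψ ∧ deriv ψ = χ := by
  obtain ⟨R, hR⟩ := h2.isCompact.isBounded.subset_closedBall (0:ℝ)
  have hz : ∀ x, R < |x| → χ x = 0 := by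
    intro x hx
    by_contra hne
    have := hR (subset_tsupport χ (Function.mem_support.2 hne))
    simp at this
    linarith
  have hd : ∀ x, HasDerivAt (fun x => ∫ t in (-R-1)..x, χ t) (χ x) x := fun x =>
    intervalIntegral.integral_hasDerivAt_right (h1.continuous.intervalIntegrable _ _)
      (h1.continuous.stronglyMeasurableAtFilter _ _) h1.continuous.continuousAt
  have hde : deriv (fun x => ∫ t in (-R-1)..x, χ t) = χ := funext fun x => (hd x).deriv
  refine ⟨_, ?_, ?_, hde⟩
  · rw [contDiff_infty_iff_deriv, hde]
    exact ⟨fun x => (hd x).differentiableAt, h1⟩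
  · apply HasCompactSupport.of_support_subset_isCompact (isCompact_Icc (a := -R-1) (b := R+1))
    intro x hx
    by_contra hcon
    apply hx
    rcases lt_or_ge x (-R-1) with h | h
    · show ∫ t in (-R-1)..x, χ t = 0
      rw [intervalIntegral.integral_symm, intervalIntegral.integral_zero_ae, neg_zero]
      refine Eventually.of_forall fun t ht => hz t ?_
      rw [uIoc_of_le h.le] at ht
      have := neg_abs_le t
      linarith [ht.2]
    · have hx' : R + 1 < x := by
        by_contra h'
        exact hcon ⟨h, not_lt.1 h'⟩
      show ∫ t in (-R-1)..x, χ t = 0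
      rw [intervalIntegral.integral_eq_integral_of_support_subset, h3]
      intro t ht
      have : |t| ≤ R := by
        by_contra h'
        exact ht (hz t (not_le.1 h'))
      rw [abs_le] at this
      constructor <;> linarith [this.1, this.2]

lemma dbr (w : ℝ → ℝ) (hw : LocallyIntegrable w)
    (h : ∀ ψ : ℝ → ℝ, ContDiff ℝ (⊤ : ℕ∞) ψ → HasCompactSupport ψ →
      ∫ ξ, w ξ * deriv ψ ξ = 0) : ∃ K : ℝ, ∀ᵐ x, w x = K := by
  let B : ContDiffBump (0:ℝ) := default
  set θ : ℝ → ℝ := B.normed volume with hθ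
  have t1 : ContDiff ℝ (⊤ : ℕ∞) θ := B.contDiff_normed
  have t2 : HasCompactSupport θ := B.hasCompactSupport_normed
  have t3 : ∫ x, θ x = 1 := B.integral_normed
  refine ⟨∫ x, w x * θ x, ?_⟩
  refine ae_eq_of_integral_contDiff_smul_eq hw (locallyIntegrable_const _) ?_
  intro χ c1 c2
  have iw : ∀ g : ℝ → ℝ, Continuous g → HasCompactSupport g → Integrable (fun x => w x * g x) := by
    intro g h1 h2
    have := hw.integrable_smul_left_of_hasCompactSupport h1 h2
    simpa [mul_comm] using this
  set I := ∫ x, χ x with hI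
  obtain ⟨ψ, p1, p2, p3⟩ := exists_primitive (fun x => χ x - I * θ x)
    (c1.sub (contDiff_const.mul t1)) (c2.sub (t2.mul_left))
    (by
      rw [integral_sub (c1.continuous.integrable_of_hasCompactSupport c2)
        ((t1.continuous.integrable_of_hasCompactSupport t2).const_mul _), integral_const_mul, t3]
      simp [hI])
  have := h ψ p1 p2
  rw [p3] at this
  have e : (fun x => w x * (χ x - I * θ x)) = fun x => w x * χ x - I * (w x * θ x) := by
    ext x; ring
  rw [e, integral_sub (iw χ c1.continuous c2) ((iw θ t1.continuous t2).const_mul _),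
    integral_const_mul] at this
  simp only [smul_eq_mul]
  rw [integral_mul_const, ← hI]
  simp only [mul_comm (χ _)]
  linarith

/-- pointwise profile equation -/
lemma profile_ode (D G φ : ℝ → ℝ) (ℓ : ℝ) (hD : Continuous D) (hG : Continuous G)
    (hφ : Continuous φ) (S : Set ℝ) (hS : S.Countable) (hd : ∀ ξ ∉ S, DifferentiableAt ℝ φ ξ)
    (hli : LocallyIntegrable (fun ξ => D (φ ξ) * deriv φ ξ))
    (K : ℝ) (hae : ∀ᵐ ξ, D (φ ξ) * deriv φ ξ - G (φ ξ) = K)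
    (hlim : Tendsto φ atBot (𝓝 ℓ)) :
    ∀ ξ ∉ S, D (φ ξ) * deriv φ ξ = G (φ ξ) - G ℓ := by
  have hP : ∀ r, HasDerivAt (fun r => ∫ s in (0:ℝ)..r, D s) (D r) r := fun r =>
    intervalIntegral.integral_hasDerivAt_right (hD.intervalIntegrable _ _)
      (hD.stronglyMeasurableAtFilter _ _) hD.continuousAt
  set P : ℝ → ℝ := fun r => ∫ s in (0:ℝ)..r, D s with hPdef
  have hPc : Continuous P := continuous_iff_continuousAt.2 fun r => (hP r).continuousAt
  have hGc : Continuous (fun ξ => G (φ ξ) + K) := by fun_prop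
  have hI : ∀ x, P (φ x) = P (φ 0) + ∫ ξ in (0:ℝ)..x, (G (φ ξ) + K) := by
    intro x
    have := MeasureTheory.integral_eq_of_hasDerivAt_off_countable (a := 0) (b := x)
      (fun ξ => P (φ ξ)) (fun ξ => D (φ ξ) * deriv φ ξ) hS
      (hPc.comp hφ).continuousOn (fun ξ hξ => (hP _).comp ξ (hd ξ hξ.2).hasDerivAt)
      (hli.integrableOn_isCompact isCompact_uIcc).intervalIntegrable
    rw [← sub_eq_iff_eq_add', ← this]
    apply intervalIntegral.integral_congr_ae
    filter_upwards [hae] with ξ h _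
    linarith
  have hder : ∀ x, HasDerivAt (fun x => P (φ x)) (G (φ x) + K) x := by
    intro x
    rw [funext hI]
    exact (intervalIntegral.integral_hasDerivAt_right (hGc.intervalIntegrable _ _)
      (hGc.stronglyMeasurableAtFilter _ _) hGc.continuousAt).const_add _
  have hK : G ℓ + K = 0 := by
    have mv : ∀ x : ℝ, ∃ y ∈ Ioo (x - 1) x, G (φ y) + K = P (φ x) - P (φ (x - 1)) := by
      intro x
      obtain ⟨y, hy, e⟩ := exists_hasDerivAt_eq_slope (fun x => P (φ x)) (fun x => G (φ x) + K)
        (show x - 1 < x by linarith) (hPc.comp hφ).continuousOn (fun y _ => hder y)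
      exact ⟨y, hy, by rw [e]; simp⟩
    choose y hy e using mv
    have hyb : Tendsto y atBot atBot := tendsto_atBot_mono (fun x => (hy x).2.le) tendsto_id
    have l1 : Tendsto (fun x => G (φ (y x)) + K) atBot (𝓝 (G ℓ + K)) :=
      ((hG.tendsto ℓ).comp (hlim.comp hyb)).add_const K
    have l2 : Tendsto (fun x => P (φ x) - P (φ (x - 1))) atBot (𝓝 (P ℓ - P ℓ)) :=
      ((hPc.tendsto ℓ).comp hlim).sub ((hPc.tendsto ℓ).comp
        (hlim.comp (tendsto_atBot_add_const_right _ (-1) tendsto_id)))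
    rw [← funext e, sub_self] at l2
    exact tendsto_nhds_unique l1 l2
  intro ξ hξ
  have := (hder ξ).unique ((hP _).comp ξ (hd ξ hξ).hasDerivAt)
  linarith

lemma wf_ode (f D : ℝ → ℝ) (c ℓm ℓp ε : ℝ) (φ : ℝ → ℝ)
    (hf : ContinuousOn f (Icc 0 1)) (hD : ContinuousOn D (Icc 0 1)) (hl : ℓm < ℓp)
    (hℓ : ℓm ∈ Icc (0:ℝ) 1)
    (h : IsWavefront f (fun ρ => ε * D ρ) c ℓm ℓp φ) :
    Monotone φ ∧ ∃ S : Set ℝ, S.Countable ∧ ∀ ξ ∉ S, DifferentiableAt ℝ φ ξ ∧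
      ε * D (φ ξ) * deriv φ ξ = f (φ ξ) - c * φ ξ - (f ℓm - c * ℓm) := by
  obtain ⟨⟨hc, hr, ⟨S, hS, hd⟩, hli, hw⟩, hmono, -, hbot, htop⟩ := h
  refine ⟨?_, S, hS, ?_⟩
  · rcases hmono with h | h
    · exact h
    · exfalso
      have h1 := h.le_of_tendsto htop 0
      have h2 := h.ge_of_tendsto hbot 0
      linarith
  · have h01 : (0:ℝ) ≤ 1 := zero_le_one
    set D' : ℝ → ℝ := IccExtend h01 (Icc (0:ℝ) 1 |>.domRestrict D) with hD'
    set f' : ℝ → ℝ := IccExtend h01 (Icc (0:ℝ) 1 |>.domRestrict f) with hf'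
    have cD : Continuous D' := (continuousOn_iff_continuous_domRestrict.1 hD).Icc_extend'
    have cf : Continuous f' := (continuousOn_iff_continuous_domRestrict.1 hf).Icc_extend'
    have eD : ∀ r ∈ Icc (0:ℝ) 1, D' r = D r := fun r hr => by
      rw [hD', IccExtend_of_mem h01 _ hr]; rfl
    have ef : ∀ r ∈ Icc (0:ℝ) 1, f' r = f r := fun r hr => by
      rw [hf', IccExtend_of_mem h01 _ hr]; rfl
    have e1 : (fun ξ => ε * D (φ ξ) * deriv φ ξ) = fun ξ => ε * D' (φ ξ) * deriv φ ξ := by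
      ext ξ; rw [eD _ (hr ξ)]
    have hw' : LocallyIntegrable (fun ξ => ε * D (φ ξ) * deriv φ ξ - f (φ ξ) + c * φ ξ) := by
      have : Continuous (fun ξ => - f' (φ ξ) + c * φ ξ) := by fun_prop
      have := hli.add this.locallyIntegrable
      have e2 : (fun ξ => ε * D (φ ξ) * deriv φ ξ - f (φ ξ) + c * φ ξ) =
          (fun ξ => ε * D (φ ξ) * deriv φ ξ) + fun ξ => - f' (φ ξ) + c * φ ξ := by
        ext ξ
        simp only [Pi.add_apply]
        rw [ef _ (hr ξ)]; ring
      rw [e2]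
      exact this
    obtain ⟨K, hK⟩ := dbr _ hw' hw
    have := profile_ode (fun r => ε * D' r) (fun r => f' r - c * r) φ ℓm (by fun_prop)
      (by fun_prop) hc S hS hd (by simpa only [e1] using hli) K
      (by
        filter_upwards [hK] with ξ h
        rw [eD _ (hr ξ), ef _ (hr ξ)]; linarith) hbot
    intro ξ hξ
    refine ⟨hd ξ hξ, ?_⟩
    have := this ξ hξ
    simpa only [eD _ (hr ξ), ef _ (hr ξ), ef _ hℓ] using this

/-- Theorem 2.8 (vanishing viscosity): the normalized profiles `φ_ε` of
`ρ_t + f(ρ)_x = ε(D(ρ)ρ_x)_x` converge, as `ε → 0⁺`, to `ℓ⁻` on `ξ < 0` and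
to `ℓ⁺` on `ξ > 0`, uniformly on `(-∞, -δ]` and `[δ, ∞)` for every `δ > 0`. -/
theorem stmt8 (f D : ℝ → ℝ) (α ℓm ℓp c : ℝ)
    (hf : ContDiffOn ℝ 1 f (Icc 0 1)) (hf0 : f 0 = 0)
    (hD : ContDiffOn ℝ 1 D (Icc 0 1))
    (hα : α ∈ Ioo (0:ℝ) 1)
    (hDpos : ∀ ρ ∈ Ioo (0:ℝ) α, 0 < D ρ) (hDneg : ∀ ρ ∈ Ioo α 1, D ρ < 0)
    (hℓm : ℓm ∈ Ico (0:ℝ) α) (hℓp : ℓp ∈ Ioc α 1)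
    (hc1 : c = (f α - f ℓm) / (α - ℓm)) (hc2 : c = (f ℓp - f α) / (ℓp - α))
    (hchord1 : ∀ ρ ∈ Ioo ℓm α, f α + c * (ρ - α) < f ρ)
    (hchord2 : ∀ ρ ∈ Ioo α ℓp, f ρ < f α + c * (ρ - α))
    (hD'α : deriv D α < 0)
    (φ : ℝ → ℝ → ℝ)
    (hwf : ∀ ε ∈ Ioc (0:ℝ) 1, IsWavefront f (fun ρ => ε * D ρ) c ℓm ℓp (φ ε))
    (hnorm : ∀ ε ∈ Ioc (0:ℝ) 1, φ ε 0 = α ∧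
      (∀ ξ < (0:ℝ), φ ε ξ < α) ∧ (∀ ξ > (0:ℝ), α < φ ε ξ)) :
    (∀ ξ < (0:ℝ), Tendsto (fun ε => φ ε ξ) (𝓝[Ioc (0:ℝ) 1] 0) (𝓝 ℓm)) ∧
    (∀ ξ > (0:ℝ), Tendsto (fun ε => φ ε ξ) (𝓝[Ioc (0:ℝ) 1] 0) (𝓝 ℓp)) ∧
    (∀ δ > (0:ℝ),
      TendstoUniformlyOn (fun ε ξ => φ ε ξ) (fun _ => ℓm) (𝓝[Ioc (0:ℝ) 1] 0)
        (Iic (-δ)) ∧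
      TendstoUniformlyOn (fun ε ξ => φ ε ξ) (fun _ => ℓp) (𝓝[Ioc (0:ℝ) 1] 0)
        (Ici δ)) := by
  have cf := hf.continuousOn
  have cD := hD.continuousOn
  obtain ⟨hm0, hmα⟩ := hℓm
  obtain ⟨hpα, hp1⟩ := hℓp
  obtain ⟨hα0, hα1⟩ := hα
  have k1 : f ℓm - c * ℓm = f α - c * α := by
    rw [eq_div_iff (by linarith)] at hc1; linarith
  set g : ℝ → ℝ := fun r => f r - c * r - (f α - c * α) with hg
  have cg : ContinuousOn g (Icc 0 1) := by fun_prop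
  have gpos : ∀ r ∈ Ioo ℓm α, 0 < g r := fun r hr => by
    have := hchord1 r hr; simp only [hg]; linarith
  have gneg : ∀ r ∈ Ioo α ℓp, g r < 0 := fun r hr => by
    have := hchord2 r hr; simp only [hg]; linarith
  have ode := fun ε hε => wf_ode f D c ℓm ℓp ε (φ ε) cf cD (by linarith)
    ⟨hm0, by linarith⟩ (hwf ε hε)
  have L := core ℓm α hmα (fun r => D r / g r) φ
    ((cD.mono fun r hr => ⟨by linarith [hr.1], by linarith [hr.2]⟩).div
      (cg.mono fun r hr => ⟨by linarith [hr.1], by linarith [hr.2]⟩) fun r hr => (gpos r hr).ne')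
    (fun r hr => div_pos (hDpos r ⟨by linarith [hr.1], hr.2⟩) (gpos r hr))
    (by
      intro ε hε
      obtain ⟨hm, S, hS, hd⟩ := ode ε hε
      obtain ⟨n0, n1, n2⟩ := hnorm ε hε
      refine ⟨(hwf ε hε).1.1, hm, n0, n1, (hwf ε hε).2.2.2.1, S, hS, ?_⟩
      intro ξ hξ h0 ha
      obtain ⟨d1, d2⟩ := hd ξ hξ
      refine ⟨_, d1.hasDerivAt, ?_⟩
      have hgp := gpos _ ⟨ha, n1 ξ h0⟩
      have : ε * D (φ ε ξ) * deriv (φ ε) ξ = g (φ ε ξ) := by rw [d2, k1]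
      have hε0 := hε.1.ne'
      field_simp
      linarith)
  have Rr := core (-ℓp) (-α) (by linarith) (fun r => D (-r) / g (-r)) (fun ε ξ => - φ ε (-ξ))
    (by
      have hmaps : MapsTo (fun r : ℝ => -r) (Ioo (-ℓp) (-α)) (Icc 0 1) := fun r hr =>
        ⟨by linarith [hr.2], by linarith [hr.1]⟩
      exact (cD.comp continuous_neg.continuousOn hmaps).div
        (cg.comp continuous_neg.continuousOn hmaps)
        fun r hr => (gneg (-r) ⟨by linarith [hr.2], by linarith [hr.1]⟩).ne)
    (fun r hr => div_pos_of_neg_of_neg (hDneg (-r) ⟨by linarith [hr.2], by linarith [hr.1]⟩)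
      (gneg (-r) ⟨by linarith [hr.2], by linarith [hr.1]⟩))
    (by
      intro ε hε
      obtain ⟨hm, S, hS, hd⟩ := ode ε hε
      obtain ⟨n0, n1, n2⟩ := hnorm ε hε
      refine ⟨((hwf ε hε).1.1.comp continuous_neg).neg, fun x y h => neg_le_neg (hm (neg_le_neg h)),
        by simp [n0], fun ξ h => neg_lt_neg (n2 (-ξ) (by linarith)),
        ((hwf ε hε).2.2.2.2.comp tendsto_neg_atBot_atTop).neg, (fun x => -x) '' S, hS.image _, ?_⟩
      intro ξ hξ h0 ha
      have hξ' : -ξ ∉ S := fun h => hξ ⟨-ξ, h, by simp⟩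
      obtain ⟨d1, d2⟩ := hd (-ξ) hξ'
      refine ⟨deriv (φ ε) (-ξ), ?_, ?_⟩
      · have := (d1.hasDerivAt.comp ξ (hasDerivAt_neg ξ)).neg
        rw [mul_neg_one, neg_neg] at this
        exact this
      · have hgp := gneg _ ⟨n2 (-ξ) (by linarith), by linarith⟩
        have : ε * D (φ ε (-ξ)) * deriv (φ ε) (-ξ) = g (φ ε (-ξ)) := by rw [d2, k1]
        have hε0 := hε.1.ne'
        have hg0 := hgp.ne
        simp only [neg_neg]
        field_simp
        linarith)
  have U : ∀ δ > (0:ℝ),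
      TendstoUniformlyOn (fun ε ξ => φ ε ξ) (fun _ => ℓm) (𝓝[Ioc (0:ℝ) 1] 0)
        (Iic (-δ)) ∧
      TendstoUniformlyOn (fun ε ξ => φ ε ξ) (fun _ => ℓp) (𝓝[Ioc (0:ℝ) 1] 0)
        (Ici δ) := by
    intro δ hδ
    constructor
    · rw [Metric.tendstoUniformlyOn_iff]
      intro η hη
      filter_upwards [L δ hδ η hη] with ε h ξ hξ
      obtain ⟨h1, h2⟩ := h ξ hξ
      rw [Real.dist_eq, abs_lt]
      constructor <;> linarith
    · rw [Metric.tendstoUniformlyOn_iff]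
      intro η hη
      filter_upwards [Rr δ hδ η hη] with ε h ξ hξ
      obtain ⟨h1, h2⟩ := h (-ξ) (neg_le_neg hξ)
      rw [neg_neg] at h1 h2
      rw [Real.dist_eq, abs_lt]
      constructor <;> linarith
  refine ⟨fun ξ hξ => ?_, fun ξ hξ => ?_, U⟩
  · exact (U (-ξ) (by linarith)).1.tendsto_at (by simp)
  · exact (U ξ hξ).2.tendsto_at (by simp)
end

section
/- Assume (f) and (D1) with threshold α ∈ (0,1), let ℓ⁻ ∈ [0,α), ℓ⁺ ∈ (α,1], assume the chord conditions with common slope c and D′(α) < 0, and for ε ∈ (0,1] let φ_ε be the unique normalized wavefront profile of ρ_t + f(ρ)_x = ε(D(ρ)ρ_x)_x from ℓ⁻ to ℓ⁺. Then for every 0 < ε₁ < ε₂ ≤ 1 and every ξ < 0 one has φ_{ε₁}(ξ) ≤ φ_{ε₂}(ξ); moreover φ_{ε₁}(ξ₀) = φ_{ε₂}(ξ₀) for some ξ₀ < 0 if and only if φ_{ε₁}(ξ) = φ_{ε₂}(ξ) = 0 for every ξ < ξ₀. -/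
open Set Filter MeasureTheory Topology

theorem aux_primitive (g : ℝ → ℝ) (hg : ContDiff ℝ (⊤ : ℕ∞) g) (hs : HasCompactSupport g)
    (h0 : ∫ x, g x = 0) :
    ∃ ψ : ℝ → ℝ, ContDiff ℝ (⊤ : ℕ∞) ψ ∧ HasCompactSupport ψ ∧ deriv ψ = g := by
  obtain ⟨R, hR⟩ := hs.isCompact.isBounded.subset_ball (0:ℝ)
  have hz : ∀ x, g x ≠ 0 → x ∈ Ioo (-R) R := by
    intro x hx
    have := hR (subset_tsupport g hx)
    rw [Real.ball_eq_Ioo] at this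
    simpa using this
  have hd : ∀ x, HasDerivAt (fun x => ∫ t in (-R)..x, g t) (g x) x := fun x =>
    intervalIntegral.integral_hasDerivAt_right (hg.continuous.intervalIntegrable _ _)
      hg.continuous.stronglyMeasurable.stronglyMeasurableAtFilter hg.continuous.continuousAt
  have hder : deriv (fun x => ∫ t in (-R)..x, g t) = g := funext fun x => (hd x).deriv
  refine ⟨fun x => ∫ t in (-R)..x, g t, ?_, ?_, hder⟩
  · rw [contDiff_infty_iff_deriv, hder]
    exact ⟨fun x => (hd x).differentiableAt, hg⟩
  · refine HasCompactSupport.of_support_subset_isCompact (isCompact_Icc (a := -R) (b := R)) ?_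
    intro x hx
    by_contra hcon
    apply hx
    simp only [mem_Icc, not_and_or, not_le] at hcon
    rcases hcon with h | h
    · show ∫ t in (-R)..x, g t = 0
      rw [intervalIntegral.integral_symm, intervalIntegral.integral_congr (g := fun _ => 0)]
      · simp
      · intro t ht
        rw [uIcc_of_le h.le] at ht
        by_contra hne
        exact absurd (hz t hne).1 (not_lt.2 ht.2)
    · show ∫ t in (-R)..x, g t = 0
      rw [intervalIntegral.integral_eq_integral_of_support_subset, h0]
      intro t ht
      have := hz t ht
      exact ⟨this.1, this.2.le.trans h.le⟩

theorem aux_dbr (h : ℝ → ℝ) (hl : LocallyIntegrable h)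
    (hw : ∀ ψ : ℝ → ℝ, ContDiff ℝ (⊤ : ℕ∞) ψ → HasCompactSupport ψ →
      ∫ ξ, h ξ * deriv ψ ξ = 0) : ∃ K : ℝ, ∀ᵐ x, h x = K := by
  let b : ContDiffBump (0:ℝ) := ⟨1, 2, one_pos, one_lt_two⟩
  set χ := b.normed volume with hχ
  have hχs : HasCompactSupport χ := b.hasCompactSupport_normed
  have hχd : ContDiff ℝ (⊤ : ℕ∞) χ := b.contDiff_normed
  have hχi : ∫ x, χ x = 1 := b.integral_normed
  have hint : ∀ g : ℝ → ℝ, ContDiff ℝ (⊤ : ℕ∞) g → HasCompactSupport g →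
      Integrable (fun x => g x * h x) := fun g hg hs => by
    simpa using hl.integrable_smul_left_of_hasCompactSupport hg.continuous hs
  refine ⟨∫ x, χ x * h x, ?_⟩
  refine ae_eq_of_integral_contDiff_smul_eq hl (locallyIntegrable_const _) ?_
  intro g hg hs
  have hgi : Integrable g := hg.continuous.integrable_of_hasCompactSupport hs
  have hχI : Integrable χ := hχd.continuous.integrable_of_hasCompactSupport hχs
  obtain ⟨ψ, h1, h2, h3⟩ := aux_primitive (fun x => g x - (∫ y, g y) * χ x)
    (hg.sub (contDiff_const.mul hχd)) (hs.sub (hχs.mul_left)) (by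
      rw [integral_sub hgi (hχI.const_mul _), integral_const_mul, hχi]; ring)
  have := hw ψ h1 h2
  rw [h3] at this
  have e : (fun ξ => h ξ * (g ξ - (∫ y, g y) * χ ξ)) =
      fun ξ => g ξ * h ξ - (∫ y, g y) * (χ ξ * h ξ) := by ext; ring
  rw [e, integral_sub (hint g hg hs) ((hint χ hχd hχs).const_mul _), integral_const_mul] at this
  simp only [smul_eq_mul]
  rw [integral_mul_const]
  linarith

theorem aux_ode (f D : ℝ → ℝ) (c ℓ : ℝ) (φ : ℝ → ℝ) (hfc : ContinuousOn f (Icc 0 1))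
    (hDc : ContinuousOn D (Icc 0 1)) (hp : IsTWProfile f D c φ)
    (hlim : Tendsto φ atBot (𝓝 ℓ)) (hℓ : ℓ ∈ Icc (0:ℝ) 1) :
    ∀ᵐ ξ, D (φ ξ) * deriv φ ξ = f (φ ξ) - f ℓ - c * (φ ξ - ℓ) := by
  obtain ⟨hφ, hmem, ⟨S, hS, hdiff⟩, hli, hw⟩ := hp
  have hfφ : Continuous (fun ξ => f (φ ξ)) := hfc.comp_continuous hφ hmem
  obtain ⟨K, hK⟩ := aux_dbr (fun ξ => D (φ ξ) * deriv φ ξ - f (φ ξ) + c * φ ξ)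
    ((hli.sub hfφ.locallyIntegrable).add (continuous_const.mul hφ).locallyIntegrable) hw
  set E : ℝ → ℝ := fun x => D (projIcc (0:ℝ) 1 zero_le_one x) with hE
  have hEc : Continuous E :=
    hDc.comp_continuous (continuous_subtype_val.comp continuous_projIcc) (fun x => (projIcc (0:ℝ) 1 zero_le_one x).2)
  have hEφ : ∀ ξ, E (φ ξ) = D (φ ξ) := fun ξ => by
    simp only [hE, projIcc_of_mem zero_le_one (hmem ξ)]
  set P : ℝ → ℝ := fun x => ∫ t in (0:ℝ)..x, E t with hP
  have hPd : ∀ x, HasDerivAt P (E x) x := fun x =>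
    intervalIntegral.integral_hasDerivAt_right (hEc.intervalIntegrable _ _)
      hEc.stronglyMeasurable.stronglyMeasurableAtFilter hEc.continuousAt
  have hPc : Continuous P := continuous_iff_continuousAt.2 fun x => (hPd x).continuousAt
  set q : ℝ → ℝ := fun ξ => f (φ ξ) - c * φ ξ + K with hq
  have hqc : Continuous q := (hfφ.sub (continuous_const.mul hφ)).add continuous_const
  have hqe : ∀ᵐ ξ, D (φ ξ) * deriv φ ξ = q ξ := by
    filter_upwards [hK] with ξ h
    simp only [hq]; linarith
  have hFTC : ∀ a, ∫ t in a..(a+1), q t = P (φ (a+1)) - P (φ a) := by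
    intro a
    have h1 : ∫ t in a..(a+1), q t = ∫ t in a..(a+1), D (φ t) * deriv φ t := by
      refine intervalIntegral.integral_congr_ae ?_
      filter_upwards [hqe] with ξ h _ using h.symm
    rw [h1]
    refine integral_eq_of_hasDerivAt_off_countable_of_le (fun t => P (φ t)) _ (by linarith) hS
      (hPc.comp hφ).continuousOn ?_ (hli.integrableOn_isCompact isCompact_uIcc).intervalIntegrable
    intro x hx
    have := (hPd (φ x)).comp x (hdiff x hx.2).hasDerivAt
    rw [hEφ] at this
    exact this
  set κ := f ℓ - c * ℓ + K with hκ
  have hfl : Tendsto (fun ξ => f (φ ξ)) atBot (𝓝 (f ℓ)) :=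
    (hfc ℓ hℓ).tendsto.comp (tendsto_nhdsWithin_iff.2 ⟨hlim, Eventually.of_forall hmem⟩)
  have hql : Tendsto q atBot (𝓝 κ) := (hfl.sub (hlim.const_mul c)).add_const K
  have hsh : Tendsto (fun a : ℝ => a + 1) atBot atBot := tendsto_atBot_add_const_right _ _ tendsto_id
  have hl0 : Tendsto (fun a => ∫ t in a..(a+1), q t) atBot (𝓝 0) := by
    have h1 : Tendsto (fun a => P (φ a)) atBot (𝓝 (P ℓ)) := (hPc.tendsto ℓ).comp hlim
    have h2 := (h1.comp hsh).sub h1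
    rw [sub_self] at h2
    refine h2.congr fun a => ?_
    rw [hFTC]; rfl
  have hlκ : Tendsto (fun a => ∫ t in a..(a+1), q t) atBot (𝓝 κ) := by
    rw [Metric.tendsto_nhds]
    intro δ hδ
    rw [Metric.tendsto_nhds] at hql
    obtain ⟨N, hN⟩ := eventually_atBot.1 (hql (δ/2) (half_pos hδ))
    filter_upwards [eventually_le_atBot (N-1)] with a ha
    have h3 : (∫ t in a..(a+1), q t) - κ = ∫ t in a..(a+1), (q t - κ) := by
      rw [intervalIntegral.integral_sub (hqc.intervalIntegrable _ _) (by simp)]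
      simp
    rw [Real.dist_eq, h3]
    have h4 := intervalIntegral.norm_integral_le_of_norm_le_const (a := a) (b := a+1)
      (f := fun t => q t - κ) (C := δ/2) (by
        intro t ht
        rw [uIoc_of_le (by linarith)] at ht
        have := hN t (by linarith [ht.2])
        rw [Real.dist_eq] at this
        exact this.le)
    simp at h4
    linarith
  have hκ0 : κ = 0 := tendsto_nhds_unique hlκ hl0
  filter_upwards [hqe] with ξ h
  rw [h]; simp only [hq]; linarith

theorem aux_H (g D H φ : ℝ → ℝ) (ε ℓ α : ℝ) (hε : 0 < ε) (hφ : Continuous φ) (S : Set ℝ)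
    (hS : S.Countable) (hdiff : ∀ ξ ∉ S, DifferentiableAt ℝ φ ξ)
    (hode : ∀ᵐ ξ, ε * D (φ ξ) * deriv φ ξ = g (φ ξ))
    (hg : ∀ ρ ∈ Ioo ℓ α, 0 < g ρ)
    (hH : ∀ ρ ∈ Ioo ℓ α, HasDerivAt H (D ρ / g ρ) ρ) (a b : ℝ) (hab : a ≤ b)
    (hin : ∀ t ∈ Icc a b, φ t ∈ Ioo ℓ α) : H (φ b) - H (φ a) = (b - a) / ε := by
  have hae : ∀ᵐ t, t ∈ Icc a b → D (φ t) / g (φ t) * deriv φ t = 1 / ε := by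
    filter_upwards [hode] with t h ht
    have := hg _ (hin t ht)
    field_simp
    linarith
  have h1 : ∫ t in a..b, D (φ t) / g (φ t) * deriv φ t = H (φ b) - H (φ a) := by
    refine integral_eq_of_hasDerivAt_off_countable_of_le (fun t => H (φ t)) _ hab hS ?_ ?_ ?_
    · intro t ht
      exact (ContinuousAt.comp (hH _ (hin t ht)).continuousAt hφ.continuousAt).continuousWithinAt
    · intro t ht
      exact (hH _ (hin t (Ioo_subset_Icc_self ht.1))).comp t (hdiff t ht.2).hasDerivAt
    · refine IntervalIntegrable.congr_ae (f := fun _ => 1 / ε) (by simp) ?_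
      rw [uIoc_of_le hab]
      refine (ae_restrict_iff' measurableSet_Ioc).2 ?_
      filter_upwards [hae] with t h ht using (h (Ioc_subset_Icc_self ht)).symm
  rw [← h1, intervalIntegral.integral_congr_ae (g := fun _ => 1 / ε)]
  · simp; ring
  · filter_upwards [hae] with t h ht
    rw [uIoc_of_le hab] at ht
    exact h (Ioc_subset_Icc_self ht)

theorem aux_lub (H φ : ℝ → ℝ) (ε ℓ α : ℝ) (hε : 0 < ε) (hφ : Continuous φ) (hm : Monotone φ)
    (hH : StrictMonoOn H (Ioo ℓ α)) (h0 : φ 0 = α) (hlt : ∀ ξ < 0, φ ξ < α)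
    (hD : ∀ a b, a ≤ b → (∀ t ∈ Icc a b, φ t ∈ Ioo ℓ α) → H (φ b) - H (φ a) = (b - a) / ε)
    (ξ : ℝ) (hξ : ξ < 0) (hξℓ : ℓ < φ ξ) :
    IsLUB (H '' Ioo ℓ α) (H (φ ξ) - ξ / ε) := by
  have key : ∀ t, ξ ≤ t → t < 0 → H (φ t) = H (φ ξ) + (t - ξ) / ε := by
    intro t h1 h2
    have := hD ξ t h1 (fun s hs => ⟨hξℓ.trans_le (hm hs.1), hlt s (hs.2.trans_lt h2)⟩)
    linarith
  have hpos : 0 < - ξ / ε := div_pos (by linarith) hε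
  constructor
  · rintro _ ⟨ρ, hρ, rfl⟩
    rcases le_total ρ (φ ξ) with h | h
    · have := hH.monotoneOn hρ ⟨hξℓ, hlt ξ hξ⟩ h
      rw [neg_div] at hpos
      linarith
    · obtain ⟨t, ht, rfl⟩ := intermediate_value_Icc hξ.le hφ.continuousOn
        (show ρ ∈ Icc (φ ξ) (φ 0) from ⟨h, h0 ▸ hρ.2.le⟩)
      have ht0 : t < 0 := lt_of_le_of_ne ht.2 (by rintro rfl; exact absurd hρ.2 (by simp [h0]))
      rw [key t ht.1 ht0, sub_div]
      have := div_neg_of_neg_of_pos ht0 hε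
      linarith
  · intro u hu
    have hT : Tendsto (fun t : ℝ => H (φ ξ) + (t - ξ) / ε) (𝓝[<] 0) (𝓝 (H (φ ξ) + (0 - ξ) / ε)) := by
      apply tendsto_nhdsWithin_of_tendsto_nhds
      apply Continuous.tendsto
      fun_prop
    have : H (φ ξ) + (0 - ξ) / ε ≤ u := by
      refine le_of_tendsto hT ?_
      filter_upwards [Ioo_mem_nhdsLT hξ] with t ht
      rw [← key t ht.1.le ht.2]
      exact hu ⟨φ t, ⟨hξℓ.trans_le (hm ht.1.le), hlt t ht.2⟩, rfl⟩
    rw [zero_sub, neg_div] at this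
    linarith

theorem aux_unb (g D H : ℝ → ℝ) (ℓ α : ℝ) (hℓα : ℓ < α) (hDc : ContinuousAt D ℓ) (hDℓ : 0 < D ℓ)
    (hgd : DifferentiableAt ℝ g ℓ) (hg0 : g ℓ = 0) (hg : ∀ ρ ∈ Ioo ℓ α, 0 < g ρ)
    (hH : ∀ ρ ∈ Ioo ℓ α, HasDerivAt H (D ρ / g ρ) ρ) (B : ℝ) :
    ∃ β ∈ Ioo ℓ α, ∀ ρ ∈ Ioo ℓ β, H ρ < B := by
  obtain ⟨C, hC, hCb⟩ := hgd.isBigO_sub.exists_pos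
  have hev : ∀ᶠ ρ in 𝓝 ℓ, ‖g ρ - g ℓ‖ ≤ C * ‖ρ - ℓ‖ ∧ D ℓ / 2 < D ρ :=
    hCb.bound.and (hDc.eventually_const_lt (half_lt_self hDℓ))
  obtain ⟨δ, hδ, hb⟩ := Metric.eventually_nhds_iff.1 hev
  set β := min (ℓ + δ) α with hβ
  have hℓβ : ℓ < β := lt_min (by linarith) hℓα
  have hβα : β ≤ α := min_le_right _ _
  set m := D ℓ / 2 / C with hmdef
  have hm : 0 < m := by positivity
  have hin : ∀ ρ ∈ Ioo ℓ β, ρ ∈ Ioo ℓ α := fun ρ h => ⟨h.1, h.2.trans_le hβα⟩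
  have hFd : ∀ ρ ∈ Ioo ℓ β, HasDerivAt (fun ρ => H ρ - m * Real.log (ρ - ℓ))
      (D ρ / g ρ - m * (1 / (ρ - ℓ))) ρ := fun ρ h => by
    have hne : ρ - ℓ ≠ 0 := (sub_pos.2 h.1).ne'
    exact (hH ρ (hin ρ h)).sub ((((hasDerivAt_id ρ).sub_const ℓ).log hne).const_mul m)
  have hmono : MonotoneOn (fun ρ => H ρ - m * Real.log (ρ - ℓ)) (Ioo ℓ β) := by
    refine monotoneOn_of_deriv_nonneg (convex_Ioo _ _)
      (fun ρ h => (hFd ρ h).continuousAt.continuousWithinAt) ?_ ?_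
    · rw [interior_Ioo]
      exact fun ρ h => (hFd ρ h).differentiableAt.differentiableWithinAt
    · rw [interior_Ioo]
      intro ρ h
      rw [(hFd ρ h).deriv]
      have hp : 0 < ρ - ℓ := sub_pos.2 h.1
      obtain ⟨h1, h2⟩ := hb (y := ρ) (by
        rw [Real.dist_eq, abs_of_pos hp]
        have := h.2.trans_le (min_le_left _ _)
        linarith)
      have hgp := hg ρ (hin ρ h)
      rw [hg0, sub_zero, Real.norm_eq_abs, Real.norm_eq_abs, abs_of_pos hgp, abs_of_pos hp] at h1
      have : m * (1 / (ρ - ℓ)) ≤ D ρ / g ρ := by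
        rw [hmdef, le_div_iff₀ hgp]
        calc D ℓ / 2 / C * (1 / (ρ - ℓ)) * g ρ ≤ D ℓ / 2 / C * (1 / (ρ - ℓ)) * (C * (ρ - ℓ)) := by
              gcongr
          _ = D ℓ / 2 := by field_simp
          _ ≤ D ρ := h2.le
      linarith
  set ρ1 := (ℓ + β) / 2 with hρ1
  have hρ1m : ρ1 ∈ Ioo ℓ β := ⟨by linarith, by linarith⟩
  set A := H ρ1 - m * Real.log (ρ1 - ℓ) with hA
  have hlog : ∀ᶠ x in 𝓝[>] (0:ℝ), Real.log x < (B - A) / m :=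
    Real.tendsto_log_nhdsGT_zero.eventually_lt_atBot _
  obtain ⟨η, hη, hηb⟩ := mem_nhdsGT_iff_exists_Ioo_subset.1 hlog
  refine ⟨min (ℓ + η) ρ1, ⟨lt_min (by linarith [mem_Ioi.1 hη]) hρ1m.1,
    (min_le_right _ _).trans_lt (hρ1m.2.trans_le hβα)⟩, ?_⟩
  intro ρ hρ
  have h1 : ρ < ℓ + η := hρ.2.trans_le (min_le_left _ _)
  have h2 : ρ < ρ1 := hρ.2.trans_le (min_le_right _ _)
  have h3 : Real.log (ρ - ℓ) < (B - A) / m := hηb ⟨by linarith [hρ.1], by linarith⟩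
  rw [lt_div_iff₀ hm] at h3
  have h4 : H ρ - m * Real.log (ρ - ℓ) ≤ A := hmono ⟨hρ.1, h2.trans hρ1m.2⟩ hρ1m h2.le
  linarith

/-- Lemma 5.1: monotonicity in `ε` of the normalized viscous profiles on `ξ < 0`,
with the equality case. -/
theorem stmt9 (f D : ℝ → ℝ) (α ℓm ℓp c : ℝ)
    (hf : ContDiffOn ℝ 1 f (Icc 0 1)) (hf0 : f 0 = 0)
    (hD : ContDiffOn ℝ 1 D (Icc 0 1))
    (hα : α ∈ Ioo (0:ℝ) 1)
    (hDpos : ∀ ρ ∈ Ioo (0:ℝ) α, 0 < D ρ) (hDneg : ∀ ρ ∈ Ioo α 1, D ρ < 0)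
    (hℓm : ℓm ∈ Ico (0:ℝ) α) (hℓp : ℓp ∈ Ioc α 1)
    (hc1 : c = (f α - f ℓm) / (α - ℓm)) (hc2 : c = (f ℓp - f α) / (ℓp - α))
    (hchord1 : ∀ ρ ∈ Ioo ℓm α, f α + c * (ρ - α) < f ρ)
    (hchord2 : ∀ ρ ∈ Ioo α ℓp, f ρ < f α + c * (ρ - α))
    (hD'α : deriv D α < 0)
    (φ : ℝ → ℝ → ℝ)
    (hwf : ∀ ε ∈ Ioc (0:ℝ) 1, IsWavefront f (fun ρ => ε * D ρ) c ℓm ℓp (φ ε))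
    (hnorm : ∀ ε ∈ Ioc (0:ℝ) 1, φ ε 0 = α ∧
      (∀ ξ < (0:ℝ), φ ε ξ < α) ∧ (∀ ξ > (0:ℝ), α < φ ε ξ)) :
    ∀ ε₁ ε₂ : ℝ, 0 < ε₁ → ε₁ < ε₂ → ε₂ ≤ 1 →
      (∀ ξ < (0:ℝ), φ ε₁ ξ ≤ φ ε₂ ξ) ∧
      (∀ ξ₀ < (0:ℝ), (φ ε₁ ξ₀ = φ ε₂ ξ₀ ↔
        ∀ ξ < ξ₀, φ ε₁ ξ = 0 ∧ φ ε₂ ξ = 0)) := by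
  intro ε₁ ε₂ hε₁ hε₁₂ hε₂
  have hα0 := hα.1
  have hα1 := hα.2
  have hfc := hf.continuousOn
  have hDc := hD.continuousOn
  have hm01 : ℓm ∈ Icc (0:ℝ) 1 := ⟨hℓm.1, (hℓm.2.trans hα1).le⟩
  have hcm : f α - f ℓm = c * (α - ℓm) := by
    rw [hc1, div_mul_cancel₀]
    exact (sub_pos.2 hℓm.2).ne'
  set g : ℝ → ℝ := fun ρ => f ρ - f ℓm - c * (ρ - ℓm) with hgdef
  have hg : ∀ ρ ∈ Ioo ℓm α, 0 < g ρ := by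
    intro ρ hρ
    have := hchord1 ρ hρ
    simp only [hgdef]
    linarith
  have hsub : ∀ ρ ∈ Ioo ℓm α, ρ ∈ Ioo (0:ℝ) 1 := fun ρ h =>
    ⟨hℓm.1.trans_lt h.1, h.2.trans hα1⟩
  have hDp : ∀ ρ ∈ Ioo ℓm α, 0 < D ρ := fun ρ h => hDpos ρ ⟨(hsub ρ h).1, h.2⟩
  have hfca : ∀ ρ ∈ Ioo (0:ℝ) 1, ContinuousAt f ρ := fun ρ h =>
    hfc.continuousAt (Icc_mem_nhds h.1 h.2)
  have hDca : ∀ ρ ∈ Ioo (0:ℝ) 1, ContinuousAt D ρ := fun ρ h =>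
    hDc.continuousAt (Icc_mem_nhds h.1 h.2)
  have hrc : ∀ ρ ∈ Ioo ℓm α, ContinuousAt (fun ρ => D ρ / g ρ) ρ := by
    intro ρ h
    refine (hDca ρ (hsub ρ h)).div ?_ (hg ρ h).ne'
    exact ((hfca ρ (hsub ρ h)).sub continuousAt_const).sub (by fun_prop)
  have hrcOn : ContinuousOn (fun ρ => D ρ / g ρ) (Ioo ℓm α) :=
    fun ρ h => (hrc ρ h).continuousWithinAt
  obtain ⟨H, hH⟩ : ∃ H : ℝ → ℝ, ∀ ρ ∈ Ioo ℓm α, HasDerivAt H (D ρ / g ρ) ρ := by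
    refine ⟨fun ρ => ∫ t in ((ℓm + α) / 2)..ρ, D t / g t, fun ρ h => ?_⟩
    have hmid : (ℓm + α) / 2 ∈ Ioo ℓm α := ⟨by linarith [hℓm.2], by linarith [hℓm.2]⟩
    refine intervalIntegral.integral_hasDerivAt_right ?_ ?_ (hrc ρ h)
    · exact (hrcOn.mono (ordConnected_Ioo.uIcc_subset hmid h)).intervalIntegrable
    · exact hrcOn.stronglyMeasurableAtFilter isOpen_Ioo ρ h
  have hHm : StrictMonoOn H (Ioo ℓm α) := by
    refine strictMonoOn_of_deriv_pos (convex_Ioo _ _)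
      (fun ρ h => (hH ρ h).continuousAt.continuousWithinAt) ?_
    rw [interior_Ioo]
    intro ρ h
    rw [(hH ρ h).deriv]
    exact div_pos (hDp ρ h) (hg ρ h)
  have hpack : ∀ ε ∈ Ioc (0:ℝ) 1, Continuous (φ ε) ∧ Monotone (φ ε) ∧ (∀ ξ, ℓm ≤ φ ε ξ) ∧
      ∀ ξ < 0, ℓm < φ ε ξ → IsLUB (H '' Ioo ℓm α) (H (φ ε ξ) - ξ / ε) := by
    intro ε hε
    obtain ⟨hp, hmon, -, hbot, htop⟩ := hwf ε hε
    have hode := aux_ode f (fun ρ => ε * D ρ) c ℓm (φ ε) hfc (continuousOn_const.mul hDc) hp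
      hbot hm01
    obtain ⟨hφ, hmem, ⟨S, hS, hdiff⟩, -, -⟩ := hp
    obtain ⟨h0, hneg, hposi⟩ := hnorm ε hε
    have hmono : Monotone (φ ε) := by
      rcases hmon with h | h
      · exact h
      · have h1 := h (show (-1:ℝ) ≤ 0 by norm_num)
        have h2 := hneg (-1) (by norm_num)
        linarith
    refine ⟨hφ, hmono, fun ξ => hmono.le_of_tendsto hbot ξ, ?_⟩
    intro ξ hξ hξℓ
    exact aux_lub H (φ ε) ε ℓm α hε.1 hφ hmono hHm h0 hneg
      (aux_H g D H (φ ε) ε ℓm α hε.1 hφ S hS hdiff hode hg hH) ξ hξ hξℓ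
  have hm1 : ε₁ ∈ Ioc (0:ℝ) 1 := ⟨hε₁, hε₁₂.le.trans hε₂⟩
  have hm2 : ε₂ ∈ Ioc (0:ℝ) 1 := ⟨hε₁.trans hε₁₂, hε₂⟩
  obtain ⟨hc₁, hmo₁, hge₁, hlub₁⟩ := hpack ε₁ hm1
  obtain ⟨hc₂, hmo₂, hge₂, hlub₂⟩ := hpack ε₂ hm2
  obtain ⟨h0₁, hneg₁, -⟩ := hnorm ε₁ hm1
  obtain ⟨h0₂, hneg₂, -⟩ := hnorm ε₂ hm2
  -- strict comparison where both exceed the left state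
  have hstrict : ∀ ξ < 0, ℓm < φ ε₁ ξ → ℓm < φ ε₂ ξ → φ ε₁ ξ < φ ε₂ ξ := by
    intro ξ hξ h1 h2
    have he := (hlub₁ ξ hξ h1).unique (hlub₂ ξ hξ h2)
    have hd : ξ / ε₁ < ξ / ε₂ := by
      rw [div_lt_div_iff₀ hε₁ hm2.1]
      nlinarith
    exact (hHm.lt_iff_lt ⟨h1, hneg₁ ξ hξ⟩ ⟨h2, hneg₂ ξ hξ⟩).1 (by linarith)
  -- last point where a profile equals the left state
  have hlast : ∀ ψ : ℝ → ℝ, Continuous ψ → Monotone ψ → (∀ ξ, ℓm ≤ ψ ξ) → ψ 0 = α →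
      ∀ ξ < 0, ψ ξ = ℓm → ∃ s, ξ ≤ s ∧ s < 0 ∧ ψ s = ℓm ∧ ∀ t > s, ℓm < ψ t := by
    intro ψ hψ hψm hψg hψ0 ξ hξ he
    have hbd : ∀ t, ψ t = ℓm → t ≤ 0 := by
      intro t ht
      by_contra hcon
      have := hψm (not_le.1 hcon).le
      linarith [hℓm.2]
    have hcl : IsClosed {t | ψ t = ℓm} := isClosed_eq hψ continuous_const
    have hB : BddAbove {t | ψ t = ℓm} := ⟨0, hbd⟩
    have hmem : sSup {t | ψ t = ℓm} ∈ {t | ψ t = ℓm} := hcl.csSup_mem ⟨ξ, he⟩ hB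
    refine ⟨sSup {t | ψ t = ℓm}, le_csSup hB he, lt_of_le_of_ne (hbd _ hmem) ?_, hmem, ?_⟩
    · intro h
      have h' : ψ (sSup {t | ψ t = ℓm}) = ℓm := hmem
      rw [h, hψ0] at h'
      linarith [hℓm.2]
    · intro t ht
      refine lt_of_le_of_ne (hψg t) fun h => ?_
      exact absurd (le_csSup hB (show t ∈ {t | ψ t = ℓm} from h.symm)) (not_le.2 ht)
  have hle : ∀ ξ < 0, φ ε₁ ξ ≤ φ ε₂ ξ := by
    intro ξ hξ
    rcases (hge₁ ξ).eq_or_lt with h1 | h1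
    · rw [← h1]; exact hge₂ ξ
    rcases (hge₂ ξ).eq_or_lt with h2 | h2
    · exfalso
      obtain ⟨s, hξs, hs0, hsl, hst⟩ := hlast (φ ε₂) hc₂ hmo₂ hge₂ h0₂ ξ hξ h2.symm
      have hT₁ : Tendsto (φ ε₁) (𝓝[>] s) (𝓝 (φ ε₁ s)) :=
        tendsto_nhdsWithin_of_tendsto_nhds (hc₁.tendsto s)
      have hT₂ : Tendsto (φ ε₂) (𝓝[>] s) (𝓝 (φ ε₂ s)) :=
        tendsto_nhdsWithin_of_tendsto_nhds (hc₂.tendsto s)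
      have : φ ε₁ s ≤ φ ε₂ s := by
        refine le_of_tendsto_of_tendsto hT₁ hT₂ ?_
        filter_upwards [Ioo_mem_nhdsGT hs0] with t ht
        exact (hstrict t ht.2 (h1.trans_le (hmo₁ (hξs.trans ht.1.le))) (hst t ht.1)).le
      have := hmo₁ hξs
      linarith
    · exact (hstrict ξ hξ h1 h2).le
  refine ⟨hle, fun ξ₀ hξ₀ => ⟨fun heq => ?_, fun hz => ?_⟩⟩
  · have h1 : φ ε₁ ξ₀ = ℓm := by
      by_contra hne
      have h1 : ℓm < φ ε₁ ξ₀ := lt_of_le_of_ne (hge₁ ξ₀) (Ne.symm hne)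
      exact absurd heq (hstrict ξ₀ hξ₀ h1 (heq ▸ h1)).ne
    have h2 : φ ε₂ ξ₀ = ℓm := heq ▸ h1
    have hℓ0 : ℓm = 0 := by
      by_contra hne
      have hℓpos : 0 < ℓm := lt_of_le_of_ne hℓm.1 (Ne.symm hne)
      have hmI : ℓm ∈ Ioo (0:ℝ) 1 := ⟨hℓpos, hℓm.2.trans hα1⟩
      have hfd : DifferentiableAt ℝ f ℓm :=
        (hf.differentiableOn one_ne_zero).differentiableAt (Icc_mem_nhds hmI.1 hmI.2)
      obtain ⟨s, hξs, hs0, hsl, hst⟩ := hlast (φ ε₁) hc₁ hmo₁ hge₁ h0₁ ξ₀ hξ₀ h1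
      have hs2 : s / 2 ∈ Ioo s 0 := ⟨by linarith, by linarith⟩
      set L := H (φ ε₁ (s/2)) - (s/2) / ε₁ with hL
      have hLub := hlub₁ (s/2) hs2.2 (hst _ hs2.1)
      obtain ⟨β, hβ, hβb⟩ := aux_unb g D H ℓm α hℓm.2 (hDca ℓm hmI) (hDpos ℓm ⟨hℓpos, hℓm.2⟩)
        ((hfd.sub_const _).sub (by fun_prop)) (by simp [hgdef]) hg hH (L + s / ε₁)
      have hev : ∀ᶠ t in 𝓝[>] s, φ ε₁ t < β := by
        have hT₁ : Tendsto (φ ε₁) (𝓝[>] s) (𝓝 (φ ε₁ s)) :=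
          tendsto_nhdsWithin_of_tendsto_nhds (hc₁.tendsto s)
        exact hT₁.eventually_lt_const (hsl ▸ hβ.1)
      obtain ⟨t, ht, htI⟩ := (hev.and (Ioo_mem_nhdsGT hs0)).exists
      have hb := hβb (φ ε₁ t) ⟨hst t htI.1, ht⟩
      have he := (hlub₁ t htI.2 (hst t htI.1)).unique hLub
      have hd : s / ε₁ < t / ε₁ := div_lt_div_of_pos_right htI.1 hε₁
      linarith
    intro ξ hξ
    have e1 := hmo₁ hξ.le
    have e2 := hmo₂ hξ.le
    have e3 := hge₁ ξ
    have e4 := hge₂ ξ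
    constructor <;> linarith
  · have key : ∀ ψ : ℝ → ℝ, Continuous ψ → (∀ ξ < ξ₀, ψ ξ = 0) → ψ ξ₀ = 0 := by
      intro ψ hψ h
      have hT : Tendsto ψ (𝓝[<] ξ₀) (𝓝 (ψ ξ₀)) :=
        tendsto_nhdsWithin_of_tendsto_nhds (hψ.tendsto ξ₀)
      refine tendsto_nhds_unique hT (tendsto_const_nhds.congr' ?_)
      filter_upwards [self_mem_nhdsWithin] with t ht using (h t ht).symm
    rw [key _ hc₁ fun ξ h => (hz ξ h).1, key _ hc₂ fun ξ h => (hz ξ h).2]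
end
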